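/- arXiv:1711.00759 — 3 statements merged into one kernel-verified Lean document; each statement's English description precedes it below -/
import Mathlib

section
/- Let n ≥ 2 and 0 < λ ≤ Λ. Let A be a symmetric n×n real matrix all of whose eigenvalues lie in [λ, Λ], let p ∈ ℝ^{n−1} with |p| ≤ 1/4, and let M be the n×n matrix with M_{ij} = δ_{ij} for i < n, M_{nj} = −p_j for j < n, and M_{nn} = 1 (the Jacobian of the boundary-flattening map y ↦ y − (0,…,0,h(y₁,…,y_{n−1})) at a point where Dh = p). Then M A Mᵀ is symmetric and every eigenvalue of M A Mᵀ lies in the interval [λ/2, 4Λ]. -/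
open Set Matrix

open scoped MatrixOrder in
/-- The eigenvalues of a symmetric real matrix lie in `[a, b]` iff its quadratic form lies between
`a` and `b` times the squared Euclidean norm. -/
theorem Matrix.IsHermitian.forall_eigenvalues_mem_Icc_iff {ι : Type*} [Fintype ι] [DecidableEq ι]
    {A : Matrix ι ι ℝ} (hA : A.IsHermitian) (a b : ℝ) :
    (∀ i, hA.eigenvalues i ∈ Icc a b) ↔
      ∀ x : ι → ℝ, x ⬝ᵥ (A *ᵥ x) ∈ Icc (a * (x ⬝ᵥ x)) (b * (x ⬝ᵥ x)) := by
  have hS : IsSelfAdjoint A := hA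
  have hscal (c : ℝ) : (algebraMap ℝ (Matrix ι ι ℝ) c).IsHermitian :=
    IsSelfAdjoint.algebraMap _ (IsSelfAdjoint.all c)
  have hform (c : ℝ) (x : ι → ℝ) : x ⬝ᵥ (algebraMap ℝ (Matrix ι ι ℝ) c *ᵥ x) = c * (x ⬝ᵥ x) := by
    simp [Algebra.algebraMap_eq_smul_one, smul_mulVec]
  have hlow : algebraMap ℝ (Matrix ι ι ℝ) a ≤ A ↔ ∀ i, a ≤ hA.eigenvalues i := by
    rw [algebraMap_le_iff_le_spectrum (R := ℝ), hA.spectrum_real_eq_range_eigenvalues,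
      forall_mem_range]
  have hupp : A ≤ algebraMap ℝ (Matrix ι ι ℝ) b ↔ ∀ i, hA.eigenvalues i ≤ b := by
    rw [le_algebraMap_iff_spectrum_le (R := ℝ), hA.spectrum_real_eq_range_eigenvalues,
      forall_mem_range]
  simp only [mem_Icc, forall_and, ← hlow, ← hupp, Matrix.le_iff, posSemidef_iff_dotProduct_mulVec,
    hA.sub (hscal a), (hscal b).sub hA, true_and, star_trivial, sub_mulVec, dotProduct_sub, hform,
    sub_nonneg]

/-- If `M` has the identity in its first `m` rows and last row `(-p, 1)` with `|p| ≤ 1/4`, then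
`Mᵀ` distorts squared Euclidean norms by a factor between `1/2` and `4`. -/
theorem dotProduct_transpose_mulVec_self_mem_Icc {m : ℕ} (p : EuclideanSpace ℝ (Fin m))
    (hp : ‖p‖ ≤ 1 / 4) (M : Matrix (Fin (m + 1)) (Fin (m + 1)) ℝ)
    (hM : ∀ i j, M i j =
      if (i : ℕ) < m then (if i = j then 1 else 0)
      else (if h : (j : ℕ) < m then -p ⟨j, h⟩ else 1)) (x : Fin (m + 1) → ℝ) :
    (Mᵀ *ᵥ x) ⬝ᵥ (Mᵀ *ᵥ x) ∈ Icc ((x ⬝ᵥ x) / 2) (4 * (x ⬝ᵥ x)) := by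
  set t := x (Fin.last m) with ht
  have hinit (j : Fin m) : (Mᵀ *ᵥ x) j.castSucc = x j.castSucc - p j * t := by
    simp [mulVec, dotProduct, Fin.sum_univ_castSucc, hM, ← ht]
    ring
  have hlast : (Mᵀ *ᵥ x) (Fin.last m) = t := by
    simp [mulVec, dotProduct, Fin.sum_univ_castSucc, hM, ← ht, (Fin.castSucc_lt_last _).ne]
  have hpp : ∑ j, p j ^ 2 ≤ 1 / 16 := by
    rw [← EuclideanSpace.real_norm_sq_eq]
    nlinarith [norm_nonneg p]
  have hcs := Finset.sum_mul_sq_le_sq_mul_sq Finset.univ (fun j => p j) (fun j => x j.castSucc)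
  have hX : 0 ≤ ∑ j : Fin m, x j.castSucc ^ 2 := Finset.sum_nonneg fun _ _ => sq_nonneg _
  have hP : 0 ≤ ∑ j, p j ^ 2 := Finset.sum_nonneg fun _ _ => sq_nonneg _
  have hxx : x ⬝ᵥ x = ∑ j : Fin m, x j.castSucc ^ 2 + t ^ 2 := by
    simp [dotProduct, Fin.sum_univ_castSucc, ← ht, sq]
  have hyy : (Mᵀ *ᵥ x) ⬝ᵥ (Mᵀ *ᵥ x) = ∑ j : Fin m, x j.castSucc ^ 2
      - 2 * t * ∑ j, p j * x j.castSucc + t ^ 2 * ∑ j, p j ^ 2 + t ^ 2 := by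
    rw [dotProduct, Fin.sum_univ_castSucc, hlast]
    simp only [hinit, Finset.mul_sum, ← Finset.sum_sub_distrib, ← Finset.sum_add_distrib, sq]
    congr 1
    exact Finset.sum_congr rfl fun _ _ => by ring
  rw [hxx, hyy]
  generalize ∑ j : Fin m, x j.castSucc ^ 2 = X at *
  generalize ∑ j, p j * x j.castSucc = S at *
  generalize ∑ j, p j ^ 2 = P at *
  have hS : 16 * S ^ 2 ≤ X := by nlinarith
  have hPt : t ^ 2 * P ≤ t ^ 2 * (1 / 16) := by gcongr
  have hPt0 : 0 ≤ t ^ 2 * P := by positivity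
  constructor
  · nlinarith [sq_nonneg (t - 4 * S)]
  · nlinarith [sq_nonneg (t + 4 * S)]

/-- **Eigenvalue bounds for the flattened coefficient matrix**: if `A` is a symmetric
`n×n` matrix with all eigenvalues in `[λ, Λ]`, `p ∈ ℝ^{n−1}` with `|p| ≤ 1/4`, and `M` is
the Jacobian of the boundary-flattening map (identity in the first `n−1` rows, last row
`(−p, 1)`), then `M A Mᵀ` is symmetric and all its eigenvalues lie in `[λ/2, 4Λ]`. -/
theorem flattened_matrix_eigenvalue_bounds
    {m : ℕ} (hm : 1 ≤ m) (lam Lam : ℝ) (hlam : 0 < lam) (hlL : lam ≤ Lam)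
    (A : Matrix (Fin (m + 1)) (Fin (m + 1)) ℝ) (hA : A.IsHermitian)
    (hev : ∀ i, hA.eigenvalues i ∈ Icc lam Lam)
    (p : EuclideanSpace ℝ (Fin m)) (hp : ‖p‖ ≤ 1 / 4)
    (M : Matrix (Fin (m + 1)) (Fin (m + 1)) ℝ)
    (hM : ∀ i j, M i j =
      if (i : ℕ) < m then (if i = j then 1 else 0)
      else (if h : (j : ℕ) < m then -p ⟨j, h⟩ else 1)) :
    ∃ hH : (M * A * Mᵀ).IsHermitian, ∀ i, hH.eigenvalues i ∈ Icc (lam / 2) (4 * Lam) := by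
  have hH : (M * A * Mᵀ).IsHermitian := by
    simpa using isHermitian_mul_mul_conjTranspose M hA
  refine ⟨hH, (hH.forall_eigenvalues_mem_Icc_iff _ _).2 fun x => ?_⟩
  obtain ⟨hl, hu⟩ := (hA.forall_eigenvalues_mem_Icc_iff _ _).1 hev (Mᵀ *ᵥ x)
  obtain ⟨hl', hu'⟩ := dotProduct_transpose_mulVec_self_mem_Icc p hp M hM x
  have hform : x ⬝ᵥ ((M * A * Mᵀ) *ᵥ x) = (Mᵀ *ᵥ x) ⬝ᵥ (A *ᵥ (Mᵀ *ᵥ x)) := by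
    rw [← mulVec_mulVec, ← mulVec_mulVec, dotProduct_mulVec, mulVec_transpose]
  rw [hform]
  constructor
  · nlinarith
  · nlinarith
end

section
/- Assume the metric g on U = (−ε,ε)³ is I-invariant. Let Σ⁺ := (−ε,ε) × [0,ε) and let u : Σ⁺ → (−ε,ε) be C² on Σ⁺ (up to the boundary line {x₂ = 0}), with u(x₁,0) = 0 for all x₁ ∈ (−ε,ε) and F(u) = 0 on (−ε,ε) × (0,ε). Define w on Σ := (−ε,ε)² by w(x₁,x₂) := u(x₁,x₂) if x₂ ≥ 0 and w(x₁,x₂) := −u(x₁,−x₂) if x₂ < 0. Then: (i) u_{22}(x₁,0) = 0 for every x₁ ∈ (−ε,ε); (ii) w is C² on Σ and satisfies F(w) = 0 on Σ; and (iii) the graph of w is invariant under the reflection I. In particular, w gives a C² minimal continuation of the minimal graph of u across the geodesic line {x₂ = x₃ = 0}. -/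
open Set Matrix

noncomputable section

/-- Points of `ℝ³`. -/
abbrev Pt3 := Fin 3 → ℝ

/-- The open cube `U = (−ε,ε)³`. -/
def Ucube (ε : ℝ) : Set Pt3 := {x | ∀ i, |x i| < ε}

/-- The signs `σ₁ = 1`, `σ₂ = σ₃ = −1` of the reflection. -/
def sg : Fin 3 → ℝ := ![1, -1, -1]

/-- The reflection `I(x₁,x₂,x₃) = (x₁,−x₂,−x₃)` about the axis `{x₂ = x₃ = 0}`. -/
def refl3 (x : Pt3) : Pt3 := fun i => sg i * x i

/-- `g` is a smooth Riemannian metric on `U = (−ε,ε)³`: a smooth field of symmetric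
positive-definite matrices. -/
def SmoothMetric (ε : ℝ) (g : Pt3 → Matrix (Fin 3) (Fin 3) ℝ) : Prop :=
  (∀ i j, ContDiffOn ℝ (⊤ : ℕ∞) (fun x => g x i j) (Ucube ε)) ∧
    ∀ x ∈ Ucube ε, (g x).PosDef

/-- `g` is invariant under the reflection `I`: `g_{ij}(I x) = σ_i σ_j g_{ij}(x)`. -/
def IInvariant (ε : ℝ) (g : Pt3 → Matrix (Fin 3) (Fin 3) ℝ) : Prop :=
  ∀ x ∈ Ucube ε, ∀ i j, g (refl3 x) i j = sg i * sg j * g x i j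

/-- Partial derivative `∂ₖ f` in `ℝ³`. -/
def pd3 (k : Fin 3) (f : Pt3 → ℝ) (x : Pt3) : ℝ := fderiv ℝ f x (Pi.single k 1)

/-- The Christoffel symbols `Γ^m_{kl}` of the metric `g`. -/
def Gamma (g : Pt3 → Matrix (Fin 3) (Fin 3) ℝ) (m k l : Fin 3) (x : Pt3) : ℝ :=
  (1 / 2) * ∑ q, (g x)⁻¹ m q *
    (pd3 k (fun y => g y q l) x + pd3 l (fun y => g y q k) x - pd3 q (fun y => g y k l) x)

/-- Partial derivative `∂ᵢ u` in `ℝ²`. -/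
def pd2 (i : Fin 2) (u : (Fin 2 → ℝ) → ℝ) (p : Fin 2 → ℝ) : ℝ := fderiv ℝ u p (Pi.single i 1)

/-- The point `(p₁, p₂, z) ∈ ℝ³` over `p = (p₁,p₂) ∈ ℝ²`. -/
def pt3 (p : Fin 2 → ℝ) (z : ℝ) : Pt3 := ![p 0, p 1, z]

/-- The adapted tangent vector `X_i = e_i + d·e₃` (with `d = ∂ᵢu`). -/
def Xv (i : Fin 2) (d : ℝ) : Pt3 :=
  fun k => (if (k : ℕ) = (i : ℕ) then 1 else 0) + (if (k : ℕ) = 2 then d else 0)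

/-- The induced metric `h_{ij} = g(X_i, X_j)` on the graph of `u`. -/
def hmat (g : Pt3 → Matrix (Fin 3) (Fin 3) ℝ) (u : (Fin 2 → ℝ) → ℝ) (p : Fin 2 → ℝ) :
    Matrix (Fin 2) (Fin 2) ℝ :=
  Matrix.of fun i j =>
    ∑ k, ∑ l, g (pt3 p (u p)) k l * Xv i (pd2 i u p) k * Xv j (pd2 j u p) l

/-- The minimal graph operator `F(u)`: the graph `x₃ = u(x₁,x₂)` is a minimal surface of
`(U, g)` exactly when `F(u) = 0`. -/
def Fmin (g : Pt3 → Matrix (Fin 3) (Fin 3) ℝ) (u : (Fin 2 → ℝ) → ℝ) (p : Fin 2 → ℝ) : ℝ :=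
  ∑ i : Fin 2, ∑ j : Fin 2,
    (hmat g u p)⁻¹ i j *
      (pd2 i (pd2 j u) p
        + Gamma g 2 i.castSucc j.castSucc (pt3 p (u p))
        + pd2 i u p * Gamma g 2 2 j.castSucc (pt3 p (u p))
        + pd2 j u p * Gamma g 2 2 i.castSucc (pt3 p (u p))
        + pd2 i u p * pd2 j u p * Gamma g 2 2 2 (pt3 p (u p))
        - ∑ m : Fin 2, pd2 m u p *
            (Gamma g m.castSucc i.castSucc j.castSucc (pt3 p (u p))
              + pd2 i u p * Gamma g m.castSucc 2 j.castSucc (pt3 p (u p))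
              + pd2 j u p * Gamma g m.castSucc i.castSucc 2 (pt3 p (u p))
              + pd2 i u p * pd2 j u p * Gamma g m.castSucc 2 2 (pt3 p (u p))))


/-- The half-open strip `Σ⁺ = (−ε,ε) × [0,ε)`. -/
def SplusSet (ε : ℝ) : Set (Fin 2 → ℝ) := {p | |p 0| < ε ∧ 0 ≤ p 1 ∧ p 1 < ε}

/-- The open rectangle `Ω⁺ = (−ε,ε) × (0,ε)`. -/
def OplusSet (ε : ℝ) : Set (Fin 2 → ℝ) := {p | |p 0| < ε ∧ 0 < p 1 ∧ p 1 < ε}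

/-- The open square `Σ = (−ε,ε)²`. -/
def SqSet (ε : ℝ) : Set (Fin 2 → ℝ) := {p | |p 0| < ε ∧ |p 1| < ε}

/-- The linear automorphism of `ι → ℝ` scaling each coordinate by a sign. -/
def signEquiv {ι : Type*} [Fintype ι] (s : ι → ℝ) (hs : ∀ i, s i * s i = 1) :
    (ι → ℝ) ≃L[ℝ] (ι → ℝ) :=
  LinearEquiv.toContinuousLinearEquiv
    { toFun := fun x i => s i * x i
      invFun := fun x i => s i * x i
      map_add' := fun x y => by ext i; simp [mul_add]
      map_smul' := fun c x => by ext i; simp [mul_left_comm]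
      left_inv := fun x => by ext i; simp [← mul_assoc, hs]
      right_inv := fun x => by ext i; simp [← mul_assoc, hs] }

@[simp]
lemma signEquiv_apply {ι : Type*} [Fintype ι] (s : ι → ℝ) (hs : ∀ i, s i * s i = 1)
    (x : ι → ℝ) (i : ι) : signEquiv s hs x i = s i * x i := rfl

/-- Partial derivatives of a function that is equivariant under a diagonal sign change. -/
lemma fderiv_single_of_sign_equivariant {ι : Type*} [Fintype ι] [DecidableEq ι] (s : ι → ℝ)
    (hs : ∀ i, s i * s i = 1) {f : (ι → ℝ) → ℝ} {c : ℝ} {x : ι → ℝ}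
    (h : ∀ᶠ y in nhds x, f (fun i => s i * y i) = c * f y) (k : ι) :
    fderiv ℝ f (fun i => s i * x i) (Pi.single k 1) = c * s k * fderiv ℝ f x (Pi.single k 1) := by
  have h1 : fderiv ℝ (f ∘ signEquiv s hs) x = c • fderiv ℝ f x := by
    have h0 : f ∘ signEquiv s hs =ᶠ[nhds x] c • f := h
    rw [h0.fderiv_eq, fderiv_const_smul_field, Pi.smul_apply]
  rw [(signEquiv s hs).comp_right_fderiv] at h1
  have h2 := congrArg (fun L : (ι → ℝ) →L[ℝ] ℝ => L (Pi.single k 1)) h1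
  have h3 : signEquiv s hs (Pi.single k 1) = s k • Pi.single k 1 := by
    ext i
    by_cases hik : i = k
    · subst hik; simp
    · simp [hik]
  simp only [ContinuousLinearMap.comp_apply, ContinuousLinearEquiv.coe_coe, h3, map_smul,
    _root_.smul_apply, smul_eq_mul] at h2
  calc _ = s k * (s k * fderiv ℝ f (fun i => s i * x i) (Pi.single k 1)) := by
        rw [← mul_assoc, hs, one_mul]
    _ = _ := by
        rw [show (fun i => s i * x i) = signEquiv s hs x from rfl, h2]; ring

/-- Inverses of matrices related by conjugation with a diagonal sign matrix. -/
lemma inv_apply_of_sign_conj {ι : Type*} [Fintype ι] [DecidableEq ι] (s : ι → ℝ)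
    (hs : ∀ i, s i * s i = 1) {A B : Matrix ι ι ℝ}
    (h : ∀ i j, B i j = s i * s j * A i j) (i j : ι) :
    B⁻¹ i j = s i * s j * A⁻¹ i j := by
  have hB : B = diagonal s * A * diagonal s := by
    ext a b
    rw [mul_diagonal, diagonal_mul, h]; ring
  have hD : (diagonal s)⁻¹ = diagonal s := by
    apply inv_eq_right_inv
    rw [diagonal_mul_diagonal, ← diagonal_one]
    exact congrArg _ (funext hs)
  rw [hB, Matrix.mul_inv_rev, Matrix.mul_inv_rev, hD, ← mul_assoc, mul_diagonal, diagonal_mul]; ring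

lemma sg_mul_self (i : Fin 3) : sg i * sg i = 1 := by
  fin_cases i <;> simp [sg]

lemma isOpen_Ucube (ε : ℝ) : IsOpen (Ucube ε) := by
  simp only [Ucube, ofPred_forall]
  exact isOpen_iInter_of_finite fun i =>
    isOpen_lt (continuous_abs.comp (continuous_apply i)) continuous_const

lemma Gamma_refl3 {ε : ℝ} {g : Pt3 → Matrix (Fin 3) (Fin 3) ℝ} (hinv : IInvariant ε g)
    {x : Pt3} (hx : x ∈ Ucube ε) (m k l : Fin 3) :
    Gamma g m k l (refl3 x) = sg m * sg k * sg l * Gamma g m k l x := by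
  have hpd : ∀ k i j, pd3 k (fun y => g y i j) (refl3 x)
      = sg i * sg j * sg k * pd3 k (fun y => g y i j) x := fun k i j =>
    fderiv_single_of_sign_equivariant sg sg_mul_self (f := fun y => g y i j) (c := sg i * sg j)
      (Filter.mem_of_superset ((isOpen_Ucube ε).mem_nhds hx) fun y hy => hinv y hy i j) k
  have hg := inv_apply_of_sign_conj sg sg_mul_self (hinv x hx)
  simp only [Gamma, hpd, hg, Finset.mul_sum]
  refine Finset.sum_congr rfl fun q _ => ?_
  linear_combination (1 / 2 * sg m * sg k * sg l * (g x)⁻¹ m q *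
    (pd3 k (fun y => g y q l) x + pd3 l (fun y => g y q k) x - pd3 q (fun y => g y k l) x)) *
      sg_mul_self q

/-- The induced metric of a graph as a function of the point and the gradient. -/
def hjet (g : Pt3 → Matrix (Fin 3) (Fin 3) ℝ) (x : Pt3) (d : Fin 2 → ℝ) :
    Matrix (Fin 2) (Fin 2) ℝ :=
  Matrix.of fun i j => ∑ k, ∑ l, g x k l * Xv i (d i) k * Xv j (d j) l

/-- The bracket of the minimal graph operator as a function of the 2-jet. -/
def Bjet (g : Pt3 → Matrix (Fin 3) (Fin 3) ℝ) (x : Pt3) (d : Fin 2 → ℝ)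
    (D : Fin 2 → Fin 2 → ℝ) (i j : Fin 2) : ℝ :=
  D i j
    + Gamma g 2 i.castSucc j.castSucc x
    + d i * Gamma g 2 2 j.castSucc x
    + d j * Gamma g 2 2 i.castSucc x
    + d i * d j * Gamma g 2 2 2 x
    - ∑ m : Fin 2, d m *
        (Gamma g m.castSucc i.castSucc j.castSucc x
          + d i * Gamma g m.castSucc 2 j.castSucc x
          + d j * Gamma g m.castSucc i.castSucc 2 x
          + d i * d j * Gamma g m.castSucc 2 2 x)

/-- The minimal graph operator as a function of the 2-jet. -/
def Fjet (g : Pt3 → Matrix (Fin 3) (Fin 3) ℝ) (x : Pt3) (d : Fin 2 → ℝ)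
    (D : Fin 2 → Fin 2 → ℝ) : ℝ :=
  ∑ i : Fin 2, ∑ j : Fin 2, (hjet g x d)⁻¹ i j * Bjet g x d D i j

lemma Fmin_eq_Fjet (g : Pt3 → Matrix (Fin 3) (Fin 3) ℝ) (u : (Fin 2 → ℝ) → ℝ)
    (p : Fin 2 → ℝ) :
    Fmin g u p =
      Fjet g (pt3 p (u p)) (fun i => pd2 i u p) (fun i j => pd2 i (pd2 j u) p) := rfl

/-- The signs of the planar reflection `(x₁,x₂) ↦ (x₁,−x₂)`. -/
def sg2 (i : Fin 2) : ℝ := sg i.castSucc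

lemma sg2_mul_self (i : Fin 2) : sg2 i * sg2 i = 1 := sg_mul_self _

lemma Xv_reflect (i : Fin 2) (d : ℝ) (k : Fin 3) :
    Xv i (-sg2 i * d) k = sg2 i * sg k * Xv i d k := by
  fin_cases i <;> fin_cases k <;> simp [Xv, sg2, sg]

lemma hjet_reflect {ε : ℝ} {g : Pt3 → Matrix (Fin 3) (Fin 3) ℝ} (hinv : IInvariant ε g)
    {x : Pt3} (hx : x ∈ Ucube ε) (d : Fin 2 → ℝ) (i j : Fin 2) :
    hjet g (refl3 x) (fun i => -sg2 i * d i) i j = sg2 i * sg2 j * hjet g x d i j := by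
  simp only [hjet, of_apply, Xv_reflect, hinv x hx, Finset.mul_sum]
  refine Finset.sum_congr rfl fun k _ => Finset.sum_congr rfl fun l _ => ?_
  calc _ = (sg k * sg k) * (sg l * sg l) *
        (sg2 i * sg2 j * (g x k l * Xv i (d i) k * Xv j (d j) l)) := by ring
    _ = _ := by simp [sg_mul_self]

lemma Bjet_reflect {ε : ℝ} {g : Pt3 → Matrix (Fin 3) (Fin 3) ℝ} (hinv : IInvariant ε g)
    {x : Pt3} (hx : x ∈ Ucube ε) (d : Fin 2 → ℝ) (D : Fin 2 → Fin 2 → ℝ) (i j : Fin 2) :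
    Bjet g (refl3 x) (fun i => -sg2 i * d i) (fun i j => -(sg2 i * sg2 j) * D i j) i j
      = -(sg2 i * sg2 j) * Bjet g x d D i j := by
  simp only [Bjet, Gamma_refl3 hinv hx, Fin.sum_univ_two]
  fin_cases i <;> fin_cases j <;> simp [sg, sg2] <;> ring

/-- The minimal graph operator changes sign under the reflection. -/
lemma Fjet_reflect {ε : ℝ} {g : Pt3 → Matrix (Fin 3) (Fin 3) ℝ} (hinv : IInvariant ε g)
    {x : Pt3} (hx : x ∈ Ucube ε) (d : Fin 2 → ℝ) (D : Fin 2 → Fin 2 → ℝ) :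
    Fjet g (refl3 x) (fun i => -sg2 i * d i) (fun i j => -(sg2 i * sg2 j) * D i j)
      = -Fjet g x d D := by
  simp only [Fjet, inv_apply_of_sign_conj sg2 sg2_mul_self (hjet_reflect hinv hx d),
    Bjet_reflect hinv hx, ← Finset.sum_neg_distrib]
  refine Finset.sum_congr rfl fun i _ => Finset.sum_congr rfl fun j _ => ?_
  calc _ = (sg2 i * sg2 i) * (sg2 j * sg2 j) *
        (-((hjet g x d)⁻¹ i j * Bjet g x d D i j)) := by ring
    _ = _ := by simp [sg2_mul_self]

lemma hjet_posDef {g : Pt3 → Matrix (Fin 3) (Fin 3) ℝ} {x : Pt3} (hg : (g x).PosDef)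
    (d : Fin 2 → ℝ) : (hjet g x d).PosDef := by
  have hE : hjet g x d = (Matrix.of fun k i => Xv i (d i) k)ᴴ * g x *
      (Matrix.of fun k i => Xv i (d i) k) := by
    ext i j
    simp only [hjet, mul_apply, of_apply, conjTranspose_apply, star_trivial, Finset.sum_mul]
    rw [Finset.sum_comm]
    exact Finset.sum_congr rfl fun k _ => Finset.sum_congr rfl fun l _ => by ring
  rw [hE]
  refine hg.conjTranspose_mul_mul_same fun a b hab => ?_
  ext i
  have := congrFun hab i.castSucc
  fin_cases i <;> simpa [mulVec, dotProduct, Xv, Fin.sum_univ_two] using this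

lemma tendsto_inv_apply {α ι : Type*} {l : Filter α} [Fintype ι] [DecidableEq ι]
    {A : α → Matrix ι ι ℝ} {A₀ : Matrix ι ι ℝ}
    (hA : ∀ i j, Filter.Tendsto (fun a => A a i j) l (nhds (A₀ i j)))
    (hdet : A₀.det ≠ 0) (i j : ι) :
    Filter.Tendsto (fun a => (A a)⁻¹ i j) l (nhds (A₀⁻¹ i j)) := by
  have h1 : Filter.Tendsto A l (nhds A₀) := tendsto_pi_nhds.2 fun i => tendsto_pi_nhds.2 (hA i)
  have h2 : ContinuousAt Inv.inv A₀ := by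
    refine continuousAt_matrix_inv _ ?_
    rw [Ring.inverse_eq_inv']
    exact continuousAt_inv₀ hdet
  exact tendsto_pi_nhds.1 (tendsto_pi_nhds.1 (h2.tendsto.comp h1) i) j

lemma continuousAt_Gamma {ε : ℝ} {g : Pt3 → Matrix (Fin 3) (Fin 3) ℝ}
    (hsm : SmoothMetric ε g) {x : Pt3} (hx : x ∈ Ucube ε) (m k l : Fin 3) :
    ContinuousAt (Gamma g m k l) x := by
  have hU := (isOpen_Ucube ε).mem_nhds hx
  have hpd : ∀ k i j, ContinuousAt (pd3 k fun y => g y i j) x := fun k i j =>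
    (((hsm.1 i j).continuousOn_fderiv_of_isOpen (isOpen_Ucube ε) (by simp)).continuousAt
      hU).clm_apply continuousAt_const
  have hinv := tendsto_inv_apply (fun i j => (hsm.1 i j).continuousOn.continuousAt hU)
    (hsm.2 x hx).det_pos.ne'
  unfold Gamma
  refine continuousAt_const.mul (tendsto_finsetSum _ fun q _ => ?_)
  exact (hinv m q).mul (((hpd k q l).add (hpd l q k)).sub (hpd q k l))

lemma tendsto_hjet {α : Type*} {l : Filter α} {ε : ℝ} {g : Pt3 → Matrix (Fin 3) (Fin 3) ℝ}
    (hsm : SmoothMetric ε g) {X : α → Pt3} {d : α → Fin 2 → ℝ} {x₀ : Pt3} {d₀ : Fin 2 → ℝ}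
    (hx₀ : x₀ ∈ Ucube ε) (hX : Filter.Tendsto X l (nhds x₀))
    (hd : ∀ i, Filter.Tendsto (fun a => d a i) l (nhds (d₀ i))) (i j : Fin 2) :
    Filter.Tendsto (fun a => hjet g (X a) (d a) i j) l (nhds (hjet g x₀ d₀ i j)) := by
  have hg : ∀ k m, Filter.Tendsto (fun a => g (X a) k m) l (nhds (g x₀ k m)) := fun k m =>
    ((hsm.1 k m).continuousOn.continuousAt ((isOpen_Ucube ε).mem_nhds hx₀)).tendsto.comp hX
  have hXv : ∀ i k, Filter.Tendsto (fun a => Xv i (d a i) k) l (nhds (Xv i (d₀ i) k)) :=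
    fun i k => by
      have : Continuous fun t => Xv i t k := by
        unfold Xv
        split_ifs <;> fun_prop
      exact (this.tendsto _).comp (hd i)
  simp only [hjet, of_apply]
  exact tendsto_finsetSum _ fun k _ => tendsto_finsetSum _ fun m _ =>
    ((hg k m).mul (hXv i k)).mul (hXv j m)

lemma tendsto_Bjet {α : Type*} {l : Filter α} {ε : ℝ} {g : Pt3 → Matrix (Fin 3) (Fin 3) ℝ}
    (hsm : SmoothMetric ε g) {X : α → Pt3} {d : α → Fin 2 → ℝ} {D : α → Fin 2 → Fin 2 → ℝ}
    {x₀ : Pt3} {d₀ : Fin 2 → ℝ} {D₀ : Fin 2 → Fin 2 → ℝ} (hx₀ : x₀ ∈ Ucube ε)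
    (hX : Filter.Tendsto X l (nhds x₀))
    (hd : ∀ i, Filter.Tendsto (fun a => d a i) l (nhds (d₀ i)))
    (hD : ∀ i j, Filter.Tendsto (fun a => D a i j) l (nhds (D₀ i j))) (i j : Fin 2) :
    Filter.Tendsto (fun a => Bjet g (X a) (d a) (D a) i j) l (nhds (Bjet g x₀ d₀ D₀ i j)) := by
  have hΓ : ∀ m k n, Filter.Tendsto (fun a => Gamma g m k n (X a)) l (nhds (Gamma g m k n x₀)) :=
    fun m k n => (continuousAt_Gamma hsm hx₀ m k n).tendsto.comp hX
  unfold Bjet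
  refine (((((hD i j).add (hΓ _ _ _)).add ((hd i).mul (hΓ _ _ _))).add
    ((hd j).mul (hΓ _ _ _))).add (((hd i).mul (hd j)).mul (hΓ _ _ _))).sub
    (tendsto_finsetSum _ fun m _ => (hd m).mul ?_)
  exact (((hΓ _ _ _).add ((hd i).mul (hΓ _ _ _))).add ((hd j).mul (hΓ _ _ _))).add
    (((hd i).mul (hd j)).mul (hΓ _ _ _))

/-- The minimal graph operator is continuous in the 2-jet. -/
lemma tendsto_Fjet {α : Type*} {l : Filter α} {ε : ℝ} {g : Pt3 → Matrix (Fin 3) (Fin 3) ℝ}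
    (hsm : SmoothMetric ε g) {X : α → Pt3} {d : α → Fin 2 → ℝ} {D : α → Fin 2 → Fin 2 → ℝ}
    {x₀ : Pt3} {d₀ : Fin 2 → ℝ} {D₀ : Fin 2 → Fin 2 → ℝ} (hx₀ : x₀ ∈ Ucube ε)
    (hX : Filter.Tendsto X l (nhds x₀))
    (hd : ∀ i, Filter.Tendsto (fun a => d a i) l (nhds (d₀ i)))
    (hD : ∀ i j, Filter.Tendsto (fun a => D a i j) l (nhds (D₀ i j))) :
    Filter.Tendsto (fun a => Fjet g (X a) (d a) (D a)) l (nhds (Fjet g x₀ d₀ D₀)) := by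
  have hi := tendsto_inv_apply (tendsto_hjet hsm hx₀ hX hd)
    (hjet_posDef (hsm.2 x₀ hx₀) d₀).det_pos.ne'
  unfold Fjet
  exact tendsto_finsetSum _ fun i _ => tendsto_finsetSum _ fun j _ =>
    (hi i j).mul (tendsto_Bjet hsm hx₀ hX hd hD i j)

/-- At a point of the axis, a jet satisfying the minimal graph equation with vanishing
derivatives along the axis has vanishing second normal derivative. -/
lemma normal_second_derivative_eq_zero {ε : ℝ} {g : Pt3 → Matrix (Fin 3) (Fin 3) ℝ}
    (hsm : SmoothMetric ε g) (hinv : IInvariant ε g) {x : Pt3} (hx : x ∈ Ucube ε)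
    (hfix : refl3 x = x) {d : Fin 2 → ℝ} {D : Fin 2 → Fin 2 → ℝ} (hd : d 0 = 0)
    (hD : D 0 0 = 0) (hF : Fjet g x d D = 0) : D 1 1 = 0 := by
  have hd' : (fun i => -sg2 i * d i) = d := by
    ext i
    fin_cases i <;> simp [sg2, sg, hd]
  have hh := inv_apply_of_sign_conj sg2 sg2_mul_self (hjet_reflect hinv hx d)
  have hB := Bjet_reflect hinv hx d (fun i j => if i = j then 0 else D i j)
  rw [hfix, hd'] at hh hB
  have h01 := hh 0 1
  have h10 := hh 1 0
  have hB0 : Bjet g x d D 0 0 = 0 := by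
    have h := hB 0 0
    simp [sg2, sg, Bjet] at h
    simp [Bjet, hD]
    linarith
  have hB1 : Bjet g x d D 1 1 = D 1 1 := by
    have h := hB 1 1
    simp [sg2, sg, Bjet] at h
    simp [Bjet]
    linarith
  simp [sg2, sg] at h01 h10
  have h01' : (hjet g x d)⁻¹ 0 1 = 0 := by linarith
  have h10' : (hjet g x d)⁻¹ 1 0 = 0 := by linarith
  simp only [Fjet, Fin.sum_univ_two, hB0, hB1, h01', h10', mul_zero, zero_mul, zero_add] at hF
  have hpos : 0 < (hjet g x d)⁻¹ 1 1 := (hjet_posDef (hsm.2 x hx) d).inv.diag_pos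
  exact (mul_eq_zero.1 hF).resolve_left (ne_of_gt hpos)

/-- The planar reflection `(x₁,x₂) ↦ (x₁,−x₂)`. -/
def refl2 : (Fin 2 → ℝ) ≃L[ℝ] (Fin 2 → ℝ) := signEquiv sg2 sg2_mul_self

@[simp]
lemma refl2_apply_zero (p : Fin 2 → ℝ) : refl2 p 0 = p 0 := by simp [refl2, sg2, sg]

@[simp]
lemma refl2_apply_one (p : Fin 2 → ℝ) : refl2 p 1 = -p 1 := by simp [refl2, sg2, sg]

lemma refl2_eq (p : Fin 2 → ℝ) : refl2 p = ![p 0, -p 1] := by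
  ext i
  fin_cases i <;> simp

@[simp]
lemma refl2_refl2 (p : Fin 2 → ℝ) : refl2 (refl2 p) = p := by
  ext i
  fin_cases i <;> simp

lemma refl2_of_axis {p : Fin 2 → ℝ} (hp : p 1 = 0) : refl2 p = p := by
  ext i
  fin_cases i <;> simp [hp]

lemma isOpen_SqSet (ε : ℝ) : IsOpen (SqSet ε) := by
  have h : ∀ i, Continuous fun p : Fin 2 → ℝ => |p i| := fun i => by fun_prop
  simp only [SqSet, ofPred_and]
  exact (isOpen_lt (h 0) continuous_const).inter (isOpen_lt (h 1) continuous_const)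

lemma isOpen_OplusSet (ε : ℝ) : IsOpen (OplusSet ε) := by
  have h0 : Continuous fun p : Fin 2 → ℝ => |p 0| := by fun_prop
  have h1 : Continuous fun p : Fin 2 → ℝ => p 1 := by fun_prop
  simp only [OplusSet, ofPred_and]
  exact (isOpen_lt h0 continuous_const).inter
    ((isOpen_lt continuous_const h1).inter (isOpen_lt h1 continuous_const))

lemma OplusSet_subset_SplusSet (ε : ℝ) : OplusSet ε ⊆ SplusSet ε :=
  fun _ hp => ⟨hp.1, hp.2.1.le, hp.2.2⟩

lemma SqSet_eq_union (ε : ℝ) : SqSet ε = SplusSet ε ∪ refl2 ⁻¹' SplusSet ε := by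
  ext p
  simp only [SqSet, SplusSet, mem_union, mem_preimage, mem_ofPred_eq, refl2_apply_zero,
    refl2_apply_one, abs_lt]
  constructor
  · rintro ⟨h0, h1, h2⟩
    rcases le_total 0 (p 1) with h | h
    · exact Or.inl ⟨h0, h, h2⟩
    · exact Or.inr ⟨h0, by linarith, by linarith⟩
  · rintro (⟨h0, h1, h2⟩ | ⟨h0, h1, h2⟩)
    · exact ⟨h0, by linarith, h2⟩
    · exact ⟨h0, by linarith, by linarith⟩

lemma refl2_mem_SqSet {ε : ℝ} {p : Fin 2 → ℝ} (hp : p ∈ SqSet ε) : refl2 p ∈ SqSet ε := by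
  simpa [SqSet] using hp

lemma uniqueDiffOn_SplusSet {ε : ℝ} (hε : 0 < ε) : UniqueDiffOn ℝ (SplusSet ε) := by
  have hc : Convex ℝ (SplusSet ε) := by
    have h0 : IsLinearMap ℝ fun p : Fin 2 → ℝ => p 0 := ⟨fun _ _ => rfl, fun _ _ => rfl⟩
    have h1 : IsLinearMap ℝ fun p : Fin 2 → ℝ => p 1 := ⟨fun _ _ => rfl, fun _ _ => rfl⟩
    have : SplusSet ε = ({p | p 0 < ε} ∩ {p | -ε < p 0}) ∩ ({p | 0 ≤ p 1} ∩ {p | p 1 < ε}) := by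
      ext p
      simp only [SplusSet, abs_lt, mem_inter_iff, mem_ofPred_eq]
      tauto
    rw [this]
    exact ((convex_halfSpace_lt h0 _).inter (convex_halfSpace_gt h0 _)).inter
      ((convex_halfSpace_ge h1 _).inter (convex_halfSpace_lt h1 _))
  refine uniqueDiffOn_convex hc ⟨![0, ε / 2],
    interior_maximal (OplusSet_subset_SplusSet ε) (isOpen_OplusSet ε) ?_⟩
  simp [OplusSet, hε]

section Glue

variable {E : Type*} [NormedAddCommGroup E] [NormedSpace ℝ E]

/-- The extension of `v` from the upper half plane to the plane by `p ↦ T (v (refl2 p))`. -/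
def reflGlue (T : E →L[ℝ] E) (v : (Fin 2 → ℝ) → E) (p : Fin 2 → ℝ) : E :=
  if 0 ≤ p 1 then v p else T (v (refl2 p))

/-- Conjugation of linear maps by `T` and the planar reflection. -/
def reflConj (T : E →L[ℝ] E) : ((Fin 2 → ℝ) →L[ℝ] E) →L[ℝ] ((Fin 2 → ℝ) →L[ℝ] E) :=
  (ContinuousLinearMap.compL ℝ (Fin 2 → ℝ) E E T).comp
    ((ContinuousLinearMap.compL ℝ (Fin 2 → ℝ) (Fin 2 → ℝ) E).flip
      (refl2 : (Fin 2 → ℝ) →L[ℝ] (Fin 2 → ℝ)))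

lemma reflConj_apply (T : E →L[ℝ] E) (A : (Fin 2 → ℝ) →L[ℝ] E) :
    reflConj T A = T.comp (A.comp (refl2 : (Fin 2 → ℝ) →L[ℝ] (Fin 2 → ℝ))) := rfl

lemma clm_ext_single {A B : (Fin 2 → ℝ) →L[ℝ] E}
    (h0 : A (Pi.single 0 1) = B (Pi.single 0 1)) (h1 : A (Pi.single 1 1) = B (Pi.single 1 1)) :
    A = B := by
  ext p
  have hp : p = p 0 • Pi.single 0 1 + p 1 • Pi.single 1 1 := by
    ext i
    fin_cases i <;> simp
  rw [hp]
  simp only [map_add, map_smul, h0, h1]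

lemma refl2_single_zero : refl2 (Pi.single 0 1) = Pi.single 0 1 := by
  ext i
  fin_cases i <;> simp

lemma refl2_single_one : refl2 (Pi.single 1 1) = -Pi.single 1 1 := by
  ext i
  fin_cases i <;> simp

lemma reflConj_eq_self {T : E →L[ℝ] E} {A : (Fin 2 → ℝ) →L[ℝ] E}
    (h0 : T (A (Pi.single 0 1)) = A (Pi.single 0 1))
    (h1 : T (A (Pi.single 1 1)) = -A (Pi.single 1 1)) : reflConj T A = A := by
  apply clm_ext_single
  · simp [reflConj_apply, refl2_single_zero, h0]
  · simp [reflConj_apply, refl2_single_one, h1]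

variable {ε : ℝ} {T : E →L[ℝ] E} {v : (Fin 2 → ℝ) → E}

lemma reflGlue_eqOn_upper : EqOn (reflGlue T v) v (SplusSet ε) :=
  fun _ hp => if_pos hp.2.1

lemma reflGlue_eqOn_lower (hT : ∀ p ∈ SplusSet ε, p 1 = 0 → T (v p) = v p) :
    EqOn (reflGlue T v) (fun p => T (v (refl2 p))) (refl2 ⁻¹' SplusSet ε) := by
  intro p hp
  have h1 : 0 ≤ -p 1 := by simpa using hp.2.1
  by_cases h : 0 ≤ p 1
  · have h0 : p 1 = 0 := by linarith
    rw [mem_preimage, refl2_of_axis h0] at hp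
    simp [reflGlue, h, refl2_of_axis h0, hT p hp h0]
  · simp [reflGlue, h]

lemma closure_halves_subset (ε : ℝ) :
    SqSet ε ∩ closure (SplusSet ε) ⊆ SplusSet ε ∧
      SqSet ε ∩ closure (refl2 ⁻¹' SplusSet ε) ⊆ refl2 ⁻¹' SplusSet ε := by
  have h1 : closure (SplusSet ε) ⊆ {p | 0 ≤ p 1} :=
    closure_minimal (fun p hp => hp.2.1) (isClosed_le continuous_const (by fun_prop))
  have h2 : closure (refl2 ⁻¹' SplusSet ε) ⊆ {p | p 1 ≤ 0} :=
    closure_minimal (fun p hp => by simpa using hp.2.1)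
      (isClosed_le (by fun_prop) continuous_const)
  constructor
  · rintro p ⟨hp, hc⟩
    exact ⟨hp.1, h1 hc, (abs_lt.1 hp.2).2⟩
  · rintro p ⟨hp, hc⟩
    refine ⟨by simpa using hp.1, by simpa using h2 hc, ?_⟩
    have := (abs_lt.1 hp.2).1
    rw [refl2_apply_one]
    linarith

lemma continuousOn_reflGlue (hv : ContinuousOn v (SplusSet ε))
    (hT : ∀ p ∈ SplusSet ε, p 1 = 0 → T (v p) = v p) :
    ContinuousOn (reflGlue T v) (SqSet ε) := by
  intro p hp
  have hc := closure_halves_subset ε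
  rw [SqSet_eq_union]
  refine ContinuousWithinAt.union ?_ ?_
  · by_cases h : p ∈ closure (SplusSet ε)
    · exact (hv.congr reflGlue_eqOn_upper) p (hc.1 ⟨hp, h⟩)
    · exact continuousWithinAt_of_notMem_closure h
  · by_cases h : p ∈ closure (refl2 ⁻¹' SplusSet ε)
    · refine ((T.continuous.comp_continuousOn
        (hv.comp refl2.continuous.continuousOn fun q hq => hq)).congr
        (reflGlue_eqOn_lower hT)) p (hc.2 ⟨hp, h⟩)
    · exact continuousWithinAt_of_notMem_closure h

lemma hasFDerivWithinAt_reflGlue {v' : (Fin 2 → ℝ) → (Fin 2 → ℝ) →L[ℝ] E}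
    (hv : ∀ p ∈ SplusSet ε, HasFDerivWithinAt v (v' p) (SplusSet ε) p)
    (hT : ∀ p ∈ SplusSet ε, p 1 = 0 → T (v p) = v p)
    (hT' : ∀ p ∈ SplusSet ε, p 1 = 0 → reflConj T (v' p) = v' p) {p : Fin 2 → ℝ}
    (hp : p ∈ SqSet ε) :
    HasFDerivWithinAt (reflGlue T v) (reflGlue (reflConj T) v' p) (SqSet ε) p := by
  have hc := closure_halves_subset ε
  rw [SqSet_eq_union]
  refine HasFDerivWithinAt.union ?_ ?_
  · by_cases h : p ∈ closure (SplusSet ε)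
    · have hp' := hc.1 ⟨hp, h⟩
      rw [reflGlue_eqOn_upper hp']
      exact (hv p hp').congr reflGlue_eqOn_upper (reflGlue_eqOn_upper hp')
    · exact .of_notMem_closure h
  · by_cases h : p ∈ closure (refl2 ⁻¹' SplusSet ε)
    · have hp' := hc.2 ⟨hp, h⟩
      rw [reflGlue_eqOn_lower hT' hp']
      refine HasFDerivWithinAt.congr ?_ (reflGlue_eqOn_lower hT) (reflGlue_eqOn_lower hT hp')
      exact T.hasFDerivAt.comp_hasFDerivWithinAt p
        ((hv _ hp').comp p refl2.hasFDerivWithinAt fun q hq => hq)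
    · exact .of_notMem_closure h

/-- The derivative along the axis of a function vanishing on the axis is zero. -/
lemma fderivWithin_tangential_eq_zero {A : (Fin 2 → ℝ) →L[ℝ] E} {p : Fin 2 → ℝ}
    (hp : p ∈ SplusSet ε) (hp1 : p 1 = 0) (hA : HasFDerivWithinAt v A (SplusSet ε) p)
    (hv : ∀ q ∈ SplusSet ε, q 1 = 0 → v q = 0) : A (Pi.single 0 1) = 0 := by
  have hε : 0 < ε := (abs_nonneg _).trans_lt hp.1
  have hmaps : MapsTo (fun t : ℝ => (![t, 0] : Fin 2 → ℝ)) (Ioo (-ε) ε) (SplusSet ε) :=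
    fun t ht => ⟨by simpa [abs_lt] using ht, by simp, by simpa using hε⟩
  have hpe : p = ![p 0, 0] := by
    ext i
    fin_cases i <;> simp [hp1]
  have hmem : p 0 ∈ Ioo (-ε) ε := abs_lt.1 hp.1
  have hpath : HasDerivWithinAt (fun t : ℝ => (![t, 0] : Fin 2 → ℝ)) (Pi.single 0 1)
      (Ioo (-ε) ε) (p 0) := by
    rw [hasDerivWithinAt_pi]
    intro i
    fin_cases i
    · simpa using (hasDerivAt_id' (p 0)).hasDerivWithinAt
    · simpa using hasDerivWithinAt_const (p 0) _ (0 : ℝ)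
  have h1 := hA.comp_hasDerivWithinAt_of_eq (p 0) hpath hmaps hpe
  have h2 : HasDerivWithinAt (v ∘ fun t : ℝ => (![t, 0] : Fin 2 → ℝ)) 0 (Ioo (-ε) ε) (p 0) :=
    (hasDerivWithinAt_const (p 0) _ (0 : E)).congr (fun t ht => hv _ (hmaps ht) rfl)
      (hv _ (hmaps hmem) rfl)
  exact (uniqueDiffOn_Ioo _ _ _ hmem).eq_deriv _ h1 h2

end Glue

lemma refl3_pt3 (p : Fin 2 → ℝ) (z : ℝ) : refl3 (pt3 p z) = pt3 (refl2 p) (-z) := by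
  ext i
  fin_cases i <;> simp [refl3, pt3, sg]

lemma pt3_mem_Ucube {ε : ℝ} {p : Fin 2 → ℝ} (hp : p ∈ SqSet ε) {z : ℝ} (hz : |z| < ε) :
    pt3 p z ∈ Ucube ε := by
  intro i
  fin_cases i
  · exact hp.1
  · exact hp.2
  · exact hz

/-- The minimal graph operator of an odd function is odd. -/
lemma Fmin_refl2_of_odd {ε : ℝ} {g : Pt3 → Matrix (Fin 3) (Fin 3) ℝ} (hinv : IInvariant ε g)
    {w : (Fin 2 → ℝ) → ℝ} (hodd : ∀ p ∈ SqSet ε, w (refl2 p) = -w p) {p : Fin 2 → ℝ}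
    (hp : p ∈ SqSet ε) (hwp : |w p| < ε) : Fmin g w (refl2 p) = -Fmin g w p := by
  have h1 : ∀ q ∈ SqSet ε, ∀ i, pd2 i w (refl2 q) = -sg2 i * pd2 i w q := fun q hq i => by
    have h := fderiv_single_of_sign_equivariant sg2 sg2_mul_self (f := w) (c := -1) (x := q)
      (Filter.mem_of_superset ((isOpen_SqSet ε).mem_nhds hq)
        fun y hy => (hodd y hy).trans (neg_one_mul _).symm) i
    rw [neg_one_mul] at h
    exact h
  have h2 : ∀ i j, pd2 i (pd2 j w) (refl2 p) = -(sg2 i * sg2 j) * pd2 i (pd2 j w) p :=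
    fun i j => by
      have h := fderiv_single_of_sign_equivariant sg2 sg2_mul_self (f := pd2 j w)
        (c := -sg2 j) (x := p) (Filter.mem_of_superset ((isOpen_SqSet ε).mem_nhds hp)
          fun y hy => h1 y hy j) i
      rw [show -(sg2 i * sg2 j) = -sg2 j * sg2 i by ring]
      exact h
  rw [Fmin_eq_Fjet, Fmin_eq_Fjet, ← Fjet_reflect hinv (pt3_mem_Ucube hp hwp), refl3_pt3,
    hodd p hp]
  simp only [h1 p hp, h2]

lemma Fmin_congr {g : Pt3 → Matrix (Fin 3) (Fin 3) ℝ} {u w : (Fin 2 → ℝ) → ℝ}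
    {p : Fin 2 → ℝ} (h : w =ᶠ[nhds p] u) : Fmin g w p = Fmin g u p := by
  have h1 : ∀ j, pd2 j w =ᶠ[nhds p] pd2 j u := fun j =>
    h.fderiv.mono fun q hq => congrArg (fun L : (Fin 2 → ℝ) →L[ℝ] ℝ => L (Pi.single j 1)) hq
  have h2 : ∀ i j, pd2 i (pd2 j w) p = pd2 i (pd2 j u) p := fun i j =>
    congrArg (fun L : (Fin 2 → ℝ) →L[ℝ] ℝ => L (Pi.single i 1)) (h1 j).fderiv_eq
  simp only [Fmin_eq_Fjet, h.eq_of_nhds, fun j => (h1 j).eq_of_nhds, h2]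

section BoundaryJet

variable {ε : ℝ} {u : (Fin 2 → ℝ) → ℝ}

/-- The second derivative of `u` relative to the half-open strip. -/
def D2plus (ε : ℝ) (u : (Fin 2 → ℝ) → ℝ) :
    (Fin 2 → ℝ) → (Fin 2 → ℝ) →L[ℝ] (Fin 2 → ℝ) →L[ℝ] ℝ :=
  fderivWithin ℝ (fderivWithin ℝ u (SplusSet ε)) (SplusSet ε)

lemma contDiffOn_fderivWithin_SplusSet (hε : 0 < ε) (hu : ContDiffOn ℝ 2 u (SplusSet ε)) :
    ContDiffOn ℝ 1 (fderivWithin ℝ u (SplusSet ε)) (SplusSet ε) :=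
  hu.fderivWithin (uniqueDiffOn_SplusSet hε) (by norm_num)

lemma hasFDerivWithinAt_D2plus (hε : 0 < ε) (hu : ContDiffOn ℝ 2 u (SplusSet ε))
    {p : Fin 2 → ℝ} (hp : p ∈ SplusSet ε) :
    HasFDerivWithinAt (fderivWithin ℝ u (SplusSet ε)) (D2plus ε u p) (SplusSet ε) p :=
  ((contDiffOn_fderivWithin_SplusSet hε hu).differentiableOn one_ne_zero p hp).hasFDerivWithinAt

lemma continuousOn_D2plus (hε : 0 < ε) (hu : ContDiffOn ℝ 2 u (SplusSet ε)) :
    ContinuousOn (D2plus ε u) (SplusSet ε) :=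
  (contDiffOn_fderivWithin_SplusSet hε hu).continuousOn_fderivWithin
    (uniqueDiffOn_SplusSet hε) le_rfl

lemma pd2_eq_fderivWithin {p : Fin 2 → ℝ} (hp : p ∈ OplusSet ε) (i : Fin 2) :
    pd2 i u p = fderivWithin ℝ u (SplusSet ε) p (Pi.single i 1) := by
  rw [fderivWithin_of_mem_nhds (Filter.mem_of_superset ((isOpen_OplusSet ε).mem_nhds hp)
    (OplusSet_subset_SplusSet ε)), pd2]

lemma pd2_pd2_eq_D2plus (hε : 0 < ε) (hu : ContDiffOn ℝ 2 u (SplusSet ε)) {p : Fin 2 → ℝ}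
    (hp : p ∈ OplusSet ε) (i j : Fin 2) :
    pd2 i (pd2 j u) p = D2plus ε u p (Pi.single i 1) (Pi.single j 1) := by
  have hO := (isOpen_OplusSet ε).mem_nhds hp
  have h1 : pd2 j u =ᶠ[nhds p] fun q => fderivWithin ℝ u (SplusSet ε) q (Pi.single j 1) :=
    Filter.mem_of_superset hO fun q hq => pd2_eq_fderivWithin hq j
  have h2 := ((hasFDerivWithinAt_D2plus hε hu (OplusSet_subset_SplusSet ε hp)).hasFDerivAt
    (Filter.mem_of_superset hO (OplusSet_subset_SplusSet ε))).clm_apply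
    (hasFDerivAt_const (Pi.single j (1 : ℝ) : Fin 2 → ℝ) p)
  rw [pd2, h1.fderiv_eq, h2.fderiv]
  simp

variable {p : Fin 2 → ℝ}

lemma tendsto_pd2_pd2 (hε : 0 < ε) (hu : ContDiffOn ℝ 2 u (SplusSet ε)) (hp : p ∈ SplusSet ε)
    (i j : Fin 2) :
    Filter.Tendsto (fun q => pd2 i (pd2 j u) q) (nhdsWithin p (OplusSet ε))
      (nhds (D2plus ε u p (Pi.single i 1) (Pi.single j 1))) :=
  ((((continuousOn_D2plus hε hu).clm_apply continuousOn_const).clm_apply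
    continuousOn_const p hp).mono_left (nhdsWithin_mono p (OplusSet_subset_SplusSet ε))).congr'
    (eventually_nhdsWithin_of_forall fun _ hq => (pd2_pd2_eq_D2plus hε hu hq i j).symm)

lemma fderivWithin_single_zero_eq_zero (hu : ContDiffOn ℝ 2 u (SplusSet ε))
    (hu0 : ∀ q ∈ SplusSet ε, q 1 = 0 → u q = 0) (hp : p ∈ SplusSet ε) (hp1 : p 1 = 0) :
    fderivWithin ℝ u (SplusSet ε) p (Pi.single 0 1) = 0 :=
  fderivWithin_tangential_eq_zero hp hp1
    ((hu.differentiableOn two_ne_zero p hp).hasFDerivWithinAt) hu0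

lemma D2plus_zero_zero_eq_zero (hε : 0 < ε) (hu : ContDiffOn ℝ 2 u (SplusSet ε))
    (hu0 : ∀ q ∈ SplusSet ε, q 1 = 0 → u q = 0) (hp : p ∈ SplusSet ε) (hp1 : p 1 = 0) :
    D2plus ε u p (Pi.single 0 1) (Pi.single 0 1) = 0 := by
  have h := fderivWithin_tangential_eq_zero hp hp1
    ((hasFDerivWithinAt_D2plus hε hu hp).clm_apply
      (hasFDerivWithinAt_const (Pi.single 0 (1 : ℝ) : Fin 2 → ℝ) p (SplusSet ε)))
    fun q hq hq1 => fderivWithin_single_zero_eq_zero hu hu0 hq hq1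
  simpa using h

lemma mem_closure_OplusSet (hp : p ∈ SplusSet ε) : p ∈ closure (OplusSet ε) := by
  have hε : 0 < ε := (abs_nonneg _).trans_lt hp.1
  have hc : Continuous fun t : ℝ => (![p 0, t] : Fin 2 → ℝ) := by fun_prop
  have hpe : p = ![p 0, p 1] := by
    ext i
    fin_cases i <;> simp
  have h : p 1 ∈ closure (Ioo 0 ε) := by
    rw [closure_Ioo hε.ne]
    exact ⟨hp.2.1, hp.2.2.le⟩
  rw [hpe]
  exact map_mem_closure (f := fun t : ℝ => (![p 0, t] : Fin 2 → ℝ)) hc h fun t ht => ⟨hp.1, ht.1, ht.2⟩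

/-- The second normal derivative of a minimal graph vanishes on the axis of reflection. -/
lemma D2plus_one_one_eq_zero {g : Pt3 → Matrix (Fin 3) (Fin 3) ℝ} (hsm : SmoothMetric ε g)
    (hinv : IInvariant ε g) (hε : 0 < ε) (hu : ContDiffOn ℝ 2 u (SplusSet ε))
    (hu0 : ∀ q ∈ SplusSet ε, q 1 = 0 → u q = 0) (hmin : ∀ q ∈ OplusSet ε, Fmin g u q = 0)
    (hp : p ∈ SplusSet ε) (hp1 : p 1 = 0) :
    D2plus ε u p (Pi.single 1 1) (Pi.single 1 1) = 0 := by
  have hup := hu0 p hp hp1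
  have hx : pt3 p (u p) ∈ Ucube ε :=
    pt3_mem_Ucube (SqSet_eq_union ε ▸ Or.inl hp) (by simpa [hup] using hε)
  have hne : (nhdsWithin p (OplusSet ε)).NeBot :=
    mem_closure_iff_nhdsWithin_neBot.1 (mem_closure_OplusSet hp)
  have hmono : nhdsWithin p (OplusSet ε) ≤ nhdsWithin p (SplusSet ε) :=
    nhdsWithin_mono p (OplusSet_subset_SplusSet ε)
  have hX : Filter.Tendsto (fun q => pt3 q (u q)) (nhdsWithin p (OplusSet ε))
      (nhds (pt3 p (u p))) := by
    have hpt : Continuous fun z : (Fin 2 → ℝ) × ℝ => pt3 z.1 z.2 := by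
      unfold pt3
      fun_prop
    exact (hpt.tendsto (p, u p)).comp
      ((Filter.tendsto_id.mono_left nhdsWithin_le_nhds).prodMk_nhds
        ((hu.continuousOn p hp).mono_left hmono))
  have hd : ∀ i, Filter.Tendsto (fun q => pd2 i u q) (nhdsWithin p (OplusSet ε))
      (nhds (fderivWithin ℝ u (SplusSet ε) p (Pi.single i 1))) := fun i =>
    (((contDiffOn_fderivWithin_SplusSet hε hu).continuousOn.clm_apply
      continuousOn_const p hp).mono_left hmono).congr'
      (eventually_nhdsWithin_of_forall fun q hq => (pd2_eq_fderivWithin hq i).symm)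
  have hF := tendsto_Fjet hsm hx hX hd (tendsto_pd2_pd2 hε hu hp)
  have hF0 : Filter.Tendsto (fun q => Fmin g u q) (nhdsWithin p (OplusSet ε)) (nhds 0) :=
    tendsto_const_nhds.congr' (eventually_nhdsWithin_of_forall fun q hq => (hmin q hq).symm)
  refine normal_second_derivative_eq_zero (D := fun i j =>
    D2plus ε u p (Pi.single i 1) (Pi.single j 1)) hsm hinv hx ?_
    (fderivWithin_single_zero_eq_zero hu hu0 hp hp1)
    (D2plus_zero_zero_eq_zero hε hu hu0 hp hp1) (tendsto_nhds_unique hF hF0)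
  rw [refl3_pt3, refl2_of_axis hp1, hup, neg_zero]

/-- The odd reflection of a `C²` function such that `u` and `u₂₂` vanish on the
axis is `C²`. -/
lemma contDiffOn_odd_reflection (hε : 0 < ε) (hu : ContDiffOn ℝ 2 u (SplusSet ε))
    (hu0 : ∀ q ∈ SplusSet ε, q 1 = 0 → u q = 0)
    (hu22 : ∀ q ∈ SplusSet ε, q 1 = 0 → D2plus ε u q (Pi.single 1 1) (Pi.single 1 1) = 0) :
    ContDiffOn ℝ 2 (reflGlue (-ContinuousLinearMap.id ℝ ℝ) u) (SqSet ε) := by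
  have hT : ∀ q ∈ SplusSet ε, q 1 = 0 → (-ContinuousLinearMap.id ℝ ℝ) (u q) = u q :=
    fun q hq hq1 => by simp [hu0 q hq hq1]
  have hT1 : ∀ q ∈ SplusSet ε, q 1 = 0 → reflConj (-ContinuousLinearMap.id ℝ ℝ)
      (fderivWithin ℝ u (SplusSet ε) q) = fderivWithin ℝ u (SplusSet ε) q := fun q hq hq1 =>
    reflConj_eq_self (by simp [fderivWithin_single_zero_eq_zero hu hu0 hq hq1]) (by simp)
  have hT2 : ∀ q ∈ SplusSet ε, q 1 = 0 → reflConj (reflConj (-ContinuousLinearMap.id ℝ ℝ))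
      (D2plus ε u q) = D2plus ε u q := fun q hq hq1 => by
    refine reflConj_eq_self (reflConj_eq_self ?_ (by simp)) (clm_ext_single ?_ ?_)
    · simp [D2plus_zero_zero_eq_zero hε hu hu0 hq hq1]
    · simp [reflConj_apply, refl2_single_zero]
    · simp [reflConj_apply, refl2_single_one, hu22 q hq hq1]
  have hunique := (isOpen_SqSet ε).uniqueDiffOn (𝕜 := ℝ)
  rw [show (2 : WithTop ℕ∞) = 1 + 1 by norm_num,
    contDiffOn_succ_iff_hasFDerivWithinAt_of_uniqueDiffOn hunique]
  refine ⟨by simp, _, ?_, fun p hp => hasFDerivWithinAt_reflGlue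
    (fun q hq => (hu.differentiableOn two_ne_zero q hq).hasFDerivWithinAt) hT hT1 hp⟩
  rw [show (1 : WithTop ℕ∞) = 0 + 1 by norm_num,
    contDiffOn_succ_iff_hasFDerivWithinAt_of_uniqueDiffOn hunique]
  exact ⟨by simp, _, contDiffOn_zero.2 (continuousOn_reflGlue (continuousOn_D2plus hε hu) hT2),
    fun p hp => hasFDerivWithinAt_reflGlue (fun q hq => hasFDerivWithinAt_D2plus hε hu hq)
      hT1 hT2 hp⟩

end BoundaryJet

/-- **Minimal continuation across a geodesic of reflection** (core of the Main Theorem):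
let `g` be `I`-invariant on `U = (−ε,ε)³` and let `u` be `C²` up to the boundary line
`{x₂ = 0}` on `Σ⁺ = (−ε,ε) × [0,ε)`, with `u(x₁,0) = 0` and `F(u) = 0` on the open part.
Define `w` on `Σ = (−ε,ε)²` by odd reflection, `w(x₁,x₂) = u(x₁,x₂)` for `x₂ ≥ 0` and
`w(x₁,x₂) = −u(x₁,−x₂)` for `x₂ < 0`. Then: (i) the boundary value of `u₂₂` along
`{x₂ = 0}` vanishes; (ii) `w` is `C²` on `Σ` and satisfies `F(w) = 0` there; and (iii) the
graph of `w` is invariant under the reflection `I`. -/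
theorem minimal_graph_reflection_extension
    (ε : ℝ) (hε : 0 < ε) (g : Pt3 → Matrix (Fin 3) (Fin 3) ℝ)
    (hsm : SmoothMetric ε g) (hinv : IInvariant ε g)
    (u : (Fin 2 → ℝ) → ℝ)
    (hu : ContDiffOn ℝ 2 u (SplusSet ε))
    (hurange : ∀ p ∈ SplusSet ε, |u p| < ε)
    (hu0 : ∀ x₁ : ℝ, |x₁| < ε → u ![x₁, 0] = 0)
    (hmin : ∀ p ∈ OplusSet ε, Fmin g u p = 0)
    (w : (Fin 2 → ℝ) → ℝ)
    (hw : ∀ p, w p = if 0 ≤ p 1 then u p else -u ![p 0, -p 1]) :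
    (∀ x₁ : ℝ, |x₁| < ε →
      Filter.Tendsto (fun p => pd2 1 (pd2 1 u) p)
        (nhdsWithin ![x₁, 0] (OplusSet ε)) (nhds 0)) ∧
    ContDiffOn ℝ 2 w (SqSet ε) ∧
    (∀ p ∈ SqSet ε, Fmin g w p = 0) ∧
    refl3 '' ((fun p => pt3 p (w p)) '' SqSet ε) = (fun p => pt3 p (w p)) '' SqSet ε := by
  have hu0' : ∀ q ∈ SplusSet ε, q 1 = 0 → u q = 0 := fun q hq hq1 => by
    have hqe : q = ![q 0, 0] := by
      ext i
      fin_cases i <;> simp [hq1]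
    rw [hqe]
    exact hu0 _ hq.1
  have hu22 : ∀ q ∈ SplusSet ε, q 1 = 0 →
      D2plus ε u q (Pi.single 1 1) (Pi.single 1 1) = 0 := fun q hq hq1 =>
    D2plus_one_one_eq_zero hsm hinv hε hu hu0' hmin hq hq1
  have hglue : w = reflGlue (-ContinuousLinearMap.id ℝ ℝ) u := by
    ext p
    simp [hw, reflGlue, refl2_eq]
  have hupper : EqOn w u (SplusSet ε) := fun p hp => by rw [hw, if_pos hp.2.1]
  have hlower : EqOn w (fun p => -u (refl2 p)) (refl2 ⁻¹' SplusSet ε) := by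
    rw [hglue]
    exact reflGlue_eqOn_lower fun q hq hq1 => by simp [hu0' q hq hq1]
  have hodd : ∀ p ∈ SqSet ε, w (refl2 p) = -w p := by
    intro p hp
    rw [SqSet_eq_union] at hp
    rcases hp with hp | hp
    · simpa [hupper hp] using hlower (x := refl2 p) (by simpa using hp)
    · rw [hupper hp, hlower hp, neg_neg]
  have hwrange : ∀ p ∈ SqSet ε, |w p| < ε := by
    intro p hp
    rw [SqSet_eq_union] at hp
    rcases hp with hp | hp
    · rw [hupper hp]
      exact hurange p hp
    · rw [hlower hp, abs_neg]
      exact hurange _ hp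
  have hFupper : ∀ p ∈ SplusSet ε, Fmin g w p = 0 := by
    intro p hp
    rcases hp.2.1.eq_or_lt with h0 | h0
    · have hp' : p ∈ SqSet ε := SqSet_eq_union ε ▸ Or.inl hp
      have h := Fmin_refl2_of_odd hinv hodd hp' (hwrange p hp')
      rw [refl2_of_axis h0.symm] at h
      linarith
    · have hpO : p ∈ OplusSet ε := ⟨hp.1, h0, hp.2.2⟩
      rw [Fmin_congr (Filter.mem_of_superset ((isOpen_OplusSet ε).mem_nhds hpO)
        fun q hq => hupper (OplusSet_subset_SplusSet ε hq)), hmin p hpO]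
  refine ⟨fun x₁ hx₁ => ?_, ?_, fun p hp => ?_, ?_⟩
  · have hp : (![x₁, 0] : Fin 2 → ℝ) ∈ SplusSet ε := ⟨hx₁, le_rfl, hε⟩
    have h := tendsto_pd2_pd2 hε hu hp 1 1
    rwa [hu22 _ hp rfl] at h
  · rw [hglue]
    exact contDiffOn_odd_reflection hε hu hu0' hu22
  · have hp' := hp
    rw [SqSet_eq_union] at hp'
    rcases hp' with h | h
    · exact hFupper p h
    · have h2 := Fmin_refl2_of_odd hinv hodd hp (hwrange p hp)
      rw [hFupper _ h] at h2
      linarith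
  · have himage : ∀ p ∈ SqSet ε, refl3 (pt3 p (w p)) = pt3 (refl2 p) (w (refl2 p)) :=
      fun p hp => by rw [refl3_pt3, hodd p hp]
    ext x
    constructor
    · rintro ⟨_, ⟨p, hp, rfl⟩, rfl⟩
      exact ⟨refl2 p, refl2_mem_SqSet hp, (himage p hp).symm⟩
    · rintro ⟨p, hp, rfl⟩
      refine ⟨_, ⟨refl2 p, refl2_mem_SqSet hp, rfl⟩, ?_⟩
      simp only [himage _ (refl2_mem_SqSet hp), refl2_refl2]

end
end

section
/- Assume the metric g on U = (−ε,ε)³ is I-invariant. Let D⁺ := {(u,v) ∈ ℝ² : u² + v² < 1, v ≥ 0} and δ₀ := {(u,0) : |u| < 1}. Let X = (x₁,x₂,x₃) : D⁺ → U be C¹ up to δ₀, with X(δ₀) contained in the axis {x₂ = x₃ = 0}, satisfying g(∂_uX, ∂_vX) = 0 at every point of δ₀ (g evaluated at X), and with ∂_uX(u,0) ≠ 0 for every u ≠ 0. Then ∂_v x₁ = 0 at every point of δ₀. -/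
open Set Matrix

noncomputable section

/-- The closed upper half-disk `D⁺`. -/
def DplusSet : Set (ℝ × ℝ) := {q | q.1 ^ 2 + q.2 ^ 2 < 1 ∧ 0 ≤ q.2}

/-- The horizontal diameter `δ₀`. -/
def delta0Set : Set (ℝ × ℝ) := {q | q.1 ^ 2 + q.2 ^ 2 < 1 ∧ q.2 = 0}

lemma mk_zero_mem_delta0Set {t : ℝ} (ht : t ∈ Ioo (-1 : ℝ) 1) : (t, (0 : ℝ)) ∈ delta0Set := by
  refine ⟨?_, rfl⟩
  have := (sq_lt_one_iff_abs_lt_one t).2 (abs_lt.2 ht)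
  simpa using this

lemma delta0Set_subset_DplusSet : delta0Set ⊆ DplusSet := fun _ hq => ⟨hq.1, hq.2.ge⟩

lemma eq_mk_zero_of_mem_delta0Set {q : ℝ × ℝ} (hq : q ∈ delta0Set) :
    q.1 ∈ Ioo (-1 : ℝ) 1 ∧ q = (q.1, 0) := by
  obtain ⟨h, h0⟩ := hq
  rw [h0] at h
  exact ⟨abs_lt.1 ((sq_lt_one_iff_abs_lt_one q.1).1 (by simpa using h)), Prod.ext rfl h0⟩

/-- A component of `X` that vanishes along `δ₀` has vanishing tangential derivative there. -/
lemma tangential_derivative_eq_zero {X : ℝ × ℝ → Pt3} {L : (ℝ × ℝ) →L[ℝ] Pt3} {i : Fin 3}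
    {t : ℝ} (ht : t ∈ Ioo (-1 : ℝ) 1) (hX : HasFDerivWithinAt X L DplusSet (t, 0))
    (h0 : ∀ q ∈ delta0Set, X q i = 0) : L ((1 : ℝ), (0 : ℝ)) i = 0 := by
  have hc : HasDerivWithinAt (fun s : ℝ => (s, (0 : ℝ))) ((1 : ℝ), (0 : ℝ)) (Ioo (-1) 1) t :=
    ((hasDerivAt_id t).prodMk (hasDerivAt_const t (0 : ℝ))).hasDerivWithinAt
  have hcomp := hX.comp_hasDerivWithinAt t hc
    fun s hs => delta0Set_subset_DplusSet (mk_zero_mem_delta0Set hs)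
  have hi := hasDerivWithinAt_pi.1 hcomp i
  have hz : HasDerivWithinAt (fun s : ℝ => X (s, 0) i) 0 (Ioo (-1) 1) t :=
    (hasDerivWithinAt_const t _ (0 : ℝ)).congr
      (fun s hs => h0 _ (mk_zero_mem_delta0Set hs)) (h0 _ (mk_zero_mem_delta0Set ht))
  exact (isOpen_Ioo.uniqueDiffWithinAt ht).eq_deriv _ hi hz

/-- Along the axis, an `I`-invariant metric has no entries mixing directions of opposite sign. -/
lemma IInvariant.apply_eq_zero {ε : ℝ} {g : Pt3 → Matrix (Fin 3) (Fin 3) ℝ}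
    (hinv : IInvariant ε g) {x : Pt3} (hx : x ∈ Ucube ε) (h1 : x 1 = 0) (h2 : x 2 = 0)
    {i j : Fin 3} (hij : sg i * sg j = -1) : g x i j = 0 := by
  have hfix : refl3 x = x := by
    funext k
    fin_cases k <;> simp [refl3, sg, h1, h2]
  have h := hinv x hx i j
  rw [hfix, hij] at h
  linarith

/-- **Vanishing of the normal derivative of the first coordinate along the axis**: let `g`
be `I`-invariant on `U = (−ε,ε)³` and let `X : D⁺ → U` be `C¹` up to `δ₀` (with continuous
derivative data `X'`), mapping `δ₀` into the axis `{x₂ = x₃ = 0}`, with `∂_uX` and `∂_vX`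
`g`-orthogonal at every point of `δ₀` and `∂_uX(u,0) ≠ 0` for `u ≠ 0`. Then `∂_v x₁ = 0`
at every point of `δ₀`. -/
theorem normal_derivative_first_coordinate_vanishes
    (ε : ℝ) (hε : 0 < ε) (g : Pt3 → Matrix (Fin 3) (Fin 3) ℝ)
    (hsm : SmoothMetric ε g) (hinv : IInvariant ε g)
    (X : ℝ × ℝ → Pt3) (X' : ℝ × ℝ → (ℝ × ℝ) →L[ℝ] Pt3)
    (hXd : ∀ q ∈ DplusSet, HasFDerivWithinAt X (X' q) DplusSet q)
    (hX'c : ContinuousOn X' DplusSet)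
    (hrange : ∀ q ∈ DplusSet, X q ∈ Ucube ε)
    (haxis : ∀ q ∈ delta0Set, X q 1 = 0 ∧ X q 2 = 0)
    (horth : ∀ q ∈ delta0Set,
      (∑ k, ∑ l, g (X q) k l * X' q ((1 : ℝ), (0 : ℝ)) k * X' q ((0 : ℝ), (1 : ℝ)) l) = 0)
    (hne : ∀ q ∈ delta0Set, q.1 ≠ 0 → X' q ((1 : ℝ), (0 : ℝ)) ≠ 0) :
    ∀ q ∈ delta0Set, X' q ((0 : ℝ), (1 : ℝ)) 0 = 0 := by
  have hoff : ∀ t ∈ Ioo (-1 : ℝ) 1, t ≠ 0 → X' (t, 0) ((0 : ℝ), (1 : ℝ)) 0 = 0 := by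
    intro t ht ht0
    have hδ := mk_zero_mem_delta0Set ht
    have hD := delta0Set_subset_DplusSet hδ
    have hu1 := tangential_derivative_eq_zero ht (hXd _ hD) fun q hq => (haxis q hq).1
    have hu2 := tangential_derivative_eq_zero ht (hXd _ hD) fun q hq => (haxis q hq).2
    have hu0 : X' (t, 0) ((1 : ℝ), (0 : ℝ)) 0 ≠ 0 := by
      intro h
      apply hne _ hδ ht0
      funext k
      fin_cases k <;> assumption
    obtain ⟨h1, h2⟩ := haxis _ hδ
    have g01 : g (X (t, 0)) 0 1 = 0 :=
      hinv.apply_eq_zero (hrange _ hD) h1 h2 (by simp [sg])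
    have g02 : g (X (t, 0)) 0 2 = 0 :=
      hinv.apply_eq_zero (hrange _ hD) h1 h2 (by simp [sg])
    have g00 : 0 < g (X (t, 0)) 0 0 := (hsm.2 _ (hrange _ hD)).diag_pos
    have horth' := horth _ hδ
    simp only [Fin.sum_univ_three, hu1, hu2, g01, g02, mul_zero, zero_mul, add_zero] at horth'
    exact (mul_eq_zero.1 horth').resolve_left (mul_ne_zero g00.ne' hu0)
  intro q hq
  obtain ⟨ht, hq0⟩ := eq_mk_zero_of_mem_delta0Set hq
  rw [hq0]
  have hcont : ContinuousOn (fun t : ℝ => X' (t, 0) ((0 : ℝ), (1 : ℝ)) 0) (Ioo (-1) 1) := by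
    have hc : ContinuousOn (fun t : ℝ => X' (t, 0)) (Ioo (-1) 1) :=
      hX'c.comp (by fun_prop)
        fun s hs => delta0Set_subset_DplusSet (mk_zero_mem_delta0Set hs)
    exact continuousOn_pi.1 (hc.clm_apply continuousOn_const) 0
  by_cases h0 : q.1 = 0
  · have hat := (hcont.continuousAt (isOpen_Ioo.mem_nhds ht)).tendsto.mono_left
      (nhdsWithin_le_nhds (s := {q.1}ᶜ))
    refine tendsto_nhds_unique_of_eventuallyEq hat tendsto_const_nhds ?_
    filter_upwards [self_mem_nhdsWithin,
      mem_nhdsWithin_of_mem_nhds (isOpen_Ioo.mem_nhds ht)] with s hs hsI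
    exact hoff s hsI fun h => hs (h.trans h0.symm)
  · exact hoff _ ht h0

end
end
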